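/- arXiv:2106.11594 — 8 statements merged into one kernel-verified Lean document; each statement's English description precedes it below -/
import Mathlib

section
/- Let B be a real n×r matrix of rank r, C a real r×m matrix of rank r, A = B·C, and let Γ ∈ ℝᵐ be a nonzero column vector whose rejection Γ⊥ := Γ − Cᵀ(C·Cᵀ)⁻¹·C·Γ is nonzero. Let A' be the (n+1)×m matrix obtained from A by appending the row Γᵀ. With A⁺ = Cᵀ(C·Cᵀ)⁻¹(Bᵀ·B)⁻¹Bᵀ and b := B·(Bᵀ·B)⁻¹(C·Cᵀ)⁻¹·C·Γ ∈ ℝⁿ, the matrix X' := [A⁺ | 0] + (Γ⊥/‖Γ⊥‖²)·[−bᵀ | 1] (the m×(n+1) matrix whose first n columns are those of A⁺ minus (Γ⊥/‖Γ⊥‖²)·bᵀ and whose last column is Γ⊥/‖Γ⊥‖²) satisfies the four Penrose equations for A'; hence X' = (A')⁺. -/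
open Matrix

lemma gram_unit {n r : ℕ} (B : Matrix (Fin n) (Fin r) ℝ) (hB : B.rank = r) :
    IsUnit (Bᵀ * B).det := by
  rw [← Matrix.isUnit_iff_isUnit_det, ← Matrix.linearIndependent_cols_iff_isUnit,
    linearIndependent_iff_card_eq_finrank_span, Set.finrank,
    ← Matrix.rank_eq_finrank_span_cols, Matrix.rank_transpose_mul_self, hB, Fintype.card_fin]

lemma upd {n m : ℕ} (A : Matrix (Fin n) (Fin m) ℝ) (P : Matrix (Fin m) (Fin n) ℝ)
    (Γ K G : Fin m → ℝ) (b : Fin n → ℝ) (c : ℝ)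
    (h1 : A * P * A = A) (h2 : P * A * P = P) (h3 : (A * P)ᵀ = A * P) (h4 : (P * A)ᵀ = P * A)
    (hK : A *ᵥ K = 0) (hΓK : Γ ⬝ᵥ K = 1) (hb : b = Γ ᵥ* P) (hG : K = c • G)
    (hG' : Γ - b ᵥ* A = G)
    (A' : Matrix (Fin (n + 1)) (Fin m) ℝ)
    (hA' : A' = Matrix.of (Fin.snoc (fun i => A i) Γ))
    (X' : Matrix (Fin m) (Fin (n + 1)) ℝ)
    (hX' : X' = Matrix.of fun i => Fin.snoc (fun j => P i j + K i * (-(b j))) (K i)) :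
    A' * X' * A' = A' ∧ X' * A' * X' = X' ∧ (A' * X')ᵀ = A' * X' ∧ (X' * A')ᵀ = X' * A' := by
  have a1 : ∀ i j, A' (Fin.castSucc i) j = A i j := by intro i j; simp [hA']
  have a2 : ∀ j, A' (Fin.last n) j = Γ j := by intro j; simp [hA']
  have x1 : ∀ i j, X' i (Fin.castSucc j) = P i j - K i * b j := by
    intro i j; simp [hX']; ring
  have x2 : ∀ i, X' i (Fin.last n) = K i := by intro j; simp [hX']
  have hK' : ∀ i, ∑ k, A i k * K k = 0 := fun i => congrFun hK i
  have hΓK' : ∑ k, Γ k * K k = 1 := hΓK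
  have hb' : ∀ j, ∑ k, Γ k * P k j = b j := fun j => by rw [hb]; rfl
  have n11 : ∀ i j, (A' * X') (Fin.castSucc i) (Fin.castSucc j) = (A * P) i j := by
    intro i j
    simp only [Matrix.mul_apply, a1, x1, mul_sub, Finset.sum_sub_distrib, ← mul_assoc,
      ← Finset.sum_mul, hK']
    ring
  have n12 : ∀ i, (A' * X') (Fin.castSucc i) (Fin.last n) = 0 := by
    intro i
    simp only [Matrix.mul_apply, a1, x2, hK']
  have n21 : ∀ j, (A' * X') (Fin.last n) (Fin.castSucc j) = 0 := by
    intro j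
    simp only [Matrix.mul_apply, a2, x1, mul_sub, Finset.sum_sub_distrib, ← mul_assoc,
      ← Finset.sum_mul, hΓK', hb']
    ring
  have n22 : (A' * X') (Fin.last n) (Fin.last n) = 1 := by
    simp only [Matrix.mul_apply, a2, x2, hΓK']
  have hbb : b ᵥ* (A * P) = b := by
    rw [hb, Matrix.vecMul_vecMul, ← Matrix.mul_assoc, h2]
  have hXA : X' * A' = P * A + c • Matrix.vecMulVec G G := by
    ext i j
    have e : G j = Γ j - ∑ k, b k * A k j := by rw [← hG']; rfl
    have e2 : K i = c * G i := by rw [hG]; rfl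
    simp only [Matrix.mul_apply, Fin.sum_univ_castSucc, a1, a2, x1, x2, Matrix.add_apply,
      Matrix.smul_apply, Matrix.vecMulVec_apply, smul_eq_mul, sub_mul, Finset.sum_sub_distrib,
      mul_assoc, ← Finset.mul_sum]
    rw [← mul_assoc c, ← e2, e]
    ring
  refine ⟨?_, ?_, ?_, ?_⟩
  · ext i j
    rw [Matrix.mul_apply, Fin.sum_univ_castSucc]
    refine Fin.lastCases ?_ (fun i => ?_) i
    · simp [n21, n22]
    · simp only [n11, n12, a1, zero_mul, add_zero]
      rw [← Matrix.mul_apply, h1]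
  · rw [Matrix.mul_assoc]
    ext i j
    rw [Matrix.mul_apply, Fin.sum_univ_castSucc]
    refine Fin.lastCases ?_ (fun j => ?_) j
    · simp [n12, n22]
    · simp only [n11, n21, x1, mul_zero, add_zero, sub_mul, Finset.sum_sub_distrib, mul_assoc,
        ← Finset.mul_sum]
      have e1 : ∑ k, P i k * (A * P) k j = P i j := by
        rw [← Matrix.mul_apply, ← Matrix.mul_assoc, h2]
      have e2 : ∑ k, b k * (A * P) k j = b j := congrFun hbb j
      rw [e1, e2]
  · ext i j
    rw [Matrix.transpose_apply]
    refine Fin.lastCases ?_ (fun i => ?_) i <;> refine Fin.lastCases ?_ (fun j => ?_) j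
    · rfl
    · rw [n12, n21]
    · rw [n12, n21]
    · rw [n11, n11]; exact congrFun (congrFun h3 i) j
  · rw [hXA, Matrix.transpose_add, h4, Matrix.transpose_smul, Matrix.transpose_vecMulVec]

/-- Pseudoinverse update when a new observation `Γ`, linearly independent of the
previous ones (nonzero rejection), is appended as a row to `A = B * C`. -/
theorem stmt_1 {n m r : ℕ}
    (B : Matrix (Fin n) (Fin r) ℝ) (C : Matrix (Fin r) (Fin m) ℝ)
    (hB : B.rank = r) (hC : C.rank = r)
    (A : Matrix (Fin n) (Fin m) ℝ) (hA : A = B * C)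
    (Γ : Fin m → ℝ) (hΓ : Γ ≠ 0)
    (Γperp : Fin m → ℝ)
    (hperp : Γperp = Γ - Cᵀ.mulVec ((C * Cᵀ)⁻¹.mulVec (C.mulVec Γ)))
    (hne : Γperp ≠ 0)
    (A' : Matrix (Fin (n + 1)) (Fin m) ℝ)
    (hA' : A' = Matrix.of (Fin.snoc (fun i => A i) Γ))
    (Aplus : Matrix (Fin m) (Fin n) ℝ)
    (hAplus : Aplus = Cᵀ * (C * Cᵀ)⁻¹ * (Bᵀ * B)⁻¹ * Bᵀ)
    (b : Fin n → ℝ)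
    (hb : b = B.mulVec ((Bᵀ * B)⁻¹.mulVec ((C * Cᵀ)⁻¹.mulVec (C.mulVec Γ))))
    (K : Fin m → ℝ) (hK : K = fun i => Γperp i / (Γperp ⬝ᵥ Γperp))
    (X' : Matrix (Fin m) (Fin (n + 1)) ℝ)
    (hX' : X' = Matrix.of fun i => Fin.snoc (fun j => Aplus i j + K i * (-(b j))) (K i)) :
    A' * X' * A' = A' ∧ X' * A' * X' = X' ∧ (A' * X')ᵀ = A' * X' ∧ (X' * A')ᵀ = X' * A' := by
  have uB := gram_unit B hB
  have uC : IsUnit (C * Cᵀ).det := by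
    have := gram_unit Cᵀ (by rw [Matrix.rank_transpose, hC])
    rwa [Matrix.transpose_transpose] at this
  have sB : ((Bᵀ * B)⁻¹)ᵀ = (Bᵀ * B)⁻¹ := by
    rw [Matrix.transpose_nonsing_inv, Matrix.transpose_mul, Matrix.transpose_transpose]
  have sC : ((C * Cᵀ)⁻¹)ᵀ = (C * Cᵀ)⁻¹ := by
    rw [Matrix.transpose_nonsing_inv, Matrix.transpose_mul, Matrix.transpose_transpose]
  have cB := Matrix.nonsing_inv_mul _ uB
  have cC := Matrix.mul_nonsing_inv _ uC
  have hAP : A * Aplus = B * (Bᵀ * B)⁻¹ * Bᵀ := by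
    calc A * Aplus = B * ((C * Cᵀ) * (C * Cᵀ)⁻¹) * (Bᵀ * B)⁻¹ * Bᵀ := by
          rw [hA, hAplus]; simp only [Matrix.mul_assoc]
      _ = _ := by rw [cC, Matrix.mul_one]
  have hPA : Aplus * A = Cᵀ * (C * Cᵀ)⁻¹ * C := by
    calc Aplus * A = Cᵀ * (C * Cᵀ)⁻¹ * ((Bᵀ * B)⁻¹ * (Bᵀ * B)) * C := by
          rw [hA, hAplus]; simp only [Matrix.mul_assoc]
      _ = _ := by rw [cB, Matrix.mul_one]
  have h1 : A * Aplus * A = A := by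
    calc A * Aplus * A = B * ((Bᵀ * B)⁻¹ * (Bᵀ * B)) * C := by
          rw [hAP, hA]; simp only [Matrix.mul_assoc]
      _ = _ := by rw [cB, Matrix.mul_one, hA]
  have h2 : Aplus * A * Aplus = Aplus := by
    calc Aplus * A * Aplus
        = Cᵀ * (C * Cᵀ)⁻¹ * ((C * Cᵀ) * (C * Cᵀ)⁻¹) * (Bᵀ * B)⁻¹ * Bᵀ := by
          rw [hPA, hAplus]; simp only [Matrix.mul_assoc]
      _ = _ := by rw [cC, Matrix.mul_one, hAplus]
  have h3 : (A * Aplus)ᵀ = A * Aplus := by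
    rw [hAP]
    simp only [Matrix.transpose_mul, sB, Matrix.transpose_transpose, Matrix.mul_assoc]
  have h4 : (Aplus * A)ᵀ = Aplus * A := by
    rw [hPA]
    simp only [Matrix.transpose_mul, sC, Matrix.transpose_transpose, Matrix.mul_assoc]
  have hp : Γperp = Γ - (Aplus * A) *ᵥ Γ := by
    rw [hperp, hPA]; simp only [Matrix.mulVec_mulVec, Matrix.mul_assoc]
  have hb2 : b = Γ ᵥ* Aplus := by
    rw [hb, ← Matrix.mulVec_transpose, hAplus]
    simp only [Matrix.transpose_mul, sB, sC, Matrix.transpose_transpose, Matrix.mulVec_mulVec,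
      Matrix.mul_assoc]
  have hAp : A *ᵥ Γperp = 0 := by
    rw [hp, Matrix.mulVec_sub, Matrix.mulVec_mulVec, ← Matrix.mul_assoc, h1, sub_self]
  have hpp : Γperp ⬝ᵥ Γperp ≠ 0 := fun h => hne (dotProduct_self_eq_zero.mp h)
  have hK2 : K = (Γperp ⬝ᵥ Γperp)⁻¹ • Γperp := by
    rw [hK]; ext i; simp [div_eq_inv_mul]
  have hbA : b ᵥ* A = (Aplus * A) *ᵥ Γ := by
    rw [hb2, Matrix.vecMul_vecMul, ← Matrix.mulVec_transpose, h4]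
  have hΓp : Γ ⬝ᵥ Γperp = Γperp ⬝ᵥ Γperp := by
    have e : Γ = Γperp + b ᵥ* A := by rw [hbA, hp]; simp
    calc Γ ⬝ᵥ Γperp = (Γperp + b ᵥ* A) ⬝ᵥ Γperp := by rw [← e]
      _ = _ := by rw [add_dotProduct, ← Matrix.dotProduct_mulVec, hAp, dotProduct_zero, add_zero]
  refine upd A Aplus Γ K Γperp b _ h1 h2 h3 h4 ?_ ?_ hb2 hK2 ?_ A' hA' X' hX'
  · rw [hK2, Matrix.mulVec_smul, hAp, smul_zero]
  · rw [hK2, dotProduct_smul, hΓp, smul_eq_mul, inv_mul_cancel₀ hpp]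
  · rw [hbA, hp]
end

section
/- Let B be a real n×r matrix of rank r, C a real r×m matrix of rank r, A = B·C, and let Γ ∈ ℝᵐ lie in the row space of A, i.e. Γ = Cᵀ·γ with γ := (C·Cᵀ)⁻¹·C·Γ. Let A' be the (n+1)×m matrix obtained from A by appending the row Γᵀ. With P := Bᵀ·B, ζ := P⁻¹·γ, C̃ := (C·Cᵀ)⁻¹·C, b := B·ζ, and A⁺ = C̃ᵀ·P⁻¹·Bᵀ, the matrix X' := [A⁺ | 0] + (C̃ᵀ·ζ)/(1 + γᵀ·ζ)·[−bᵀ | 1] satisfies the four Penrose equations for A'; hence X' = (A')⁺. -/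
open Matrix

theorem isUnit_of_rank_aux {r : ℕ} (M : Matrix (Fin r) (Fin r) ℝ) (h : M.rank = r) :
    IsUnit M.det := by
  rw [← Matrix.isUnit_iff_isUnit_det, ← Matrix.mulVec_surjective_iff_isUnit]
  have h1 : LinearMap.range M.mulVecLin = ⊤ := by
    apply Submodule.eq_top_of_finrank_eq
    rw [Matrix.rank] at h
    simp [h]
  exact LinearMap.range_eq_top.mp h1

/-- Pseudoinverse update when a new observation `Γ` lying in the row space of
`A = B * C` is appended as a row. -/
theorem stmt_2 {n m r : ℕ}
    (B : Matrix (Fin n) (Fin r) ℝ) (C : Matrix (Fin r) (Fin m) ℝ)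
    (hB : B.rank = r) (hC : C.rank = r)
    (A : Matrix (Fin n) (Fin m) ℝ) (hA : A = B * C)
    (Γ : Fin m → ℝ) (γ : Fin r → ℝ)
    (hγ : γ = (C * Cᵀ)⁻¹.mulVec (C.mulVec Γ))
    (hdep : Γ = Cᵀ.mulVec γ)
    (A' : Matrix (Fin (n + 1)) (Fin m) ℝ)
    (hA' : A' = Matrix.of (Fin.snoc (fun i => A i) Γ))
    (P : Matrix (Fin r) (Fin r) ℝ) (hP : P = Bᵀ * B)
    (ζ : Fin r → ℝ) (hζ : ζ = P⁻¹.mulVec γ)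
    (Ctilde : Matrix (Fin r) (Fin m) ℝ) (hCtilde : Ctilde = (C * Cᵀ)⁻¹ * C)
    (b : Fin n → ℝ) (hb : b = B.mulVec ζ)
    (Aplus : Matrix (Fin m) (Fin n) ℝ) (hAplus : Aplus = Ctildeᵀ * P⁻¹ * Bᵀ)
    (K : Fin m → ℝ)
    (hK : K = fun i => (Ctildeᵀ.mulVec ζ) i / (1 + γ ⬝ᵥ ζ))
    (X' : Matrix (Fin m) (Fin (n + 1)) ℝ)
    (hX' : X' = Matrix.of fun i => Fin.snoc (fun j => Aplus i j + K i * (-(b j))) (K i)) :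
    A' * X' * A' = A' ∧ X' * A' * X' = X' ∧ (A' * X')ᵀ = A' * X' ∧ (X' * A')ᵀ = X' * A' := by
  have hPu : IsUnit P.det := isUnit_of_rank_aux P (by rw [hP, Matrix.rank_transpose_mul_self, hB])
  have hCu : IsUnit (C * Cᵀ).det :=
    isUnit_of_rank_aux _ (by rw [Matrix.rank_self_mul_transpose, hC])
  have hPs : Pᵀ = P := by rw [hP]; simp
  have hPis : (P⁻¹)ᵀ = P⁻¹ := by rw [Matrix.transpose_nonsing_inv, hPs]
  have hGis : ((C * Cᵀ)⁻¹)ᵀ = (C * Cᵀ)⁻¹ := by rw [Matrix.transpose_nonsing_inv]; simp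
  have hPζ : P *ᵥ ζ = γ := by
    rw [hζ, Matrix.mulVec_mulVec, Matrix.mul_nonsing_inv _ hPu, Matrix.one_mulVec]
  have hpos : 0 ≤ γ ⬝ᵥ ζ := by
    have : γ ⬝ᵥ ζ = b ⬝ᵥ b := by
      rw [← hPζ, hP, hb, ← Matrix.mulVec_mulVec, Matrix.mulVec_transpose,
        ← Matrix.dotProduct_mulVec]
    rw [this]
    exact Finset.sum_nonneg fun i _ => mul_self_nonneg _
  obtain ⟨d, hd⟩ : ∃ d, d = 1 + γ ⬝ᵥ ζ := ⟨_, rfl⟩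
  have hd0 : d ≠ 0 := by rw [hd]; positivity
  obtain ⟨Q, hQ⟩ : ∃ Q, Q = P⁻¹ - d⁻¹ • vecMulVec ζ ζ := ⟨_, rfl⟩
  have hQs : Qᵀ = Q := by
    rw [hQ, transpose_sub, transpose_smul, hPis, transpose_vecMulVec]
  obtain ⟨B', hB'⟩ : ∃ B' : Matrix (Fin (n+1)) (Fin r) ℝ,
    B' = Matrix.of (Fin.snoc (fun i => B i) γ) := ⟨_, rfl⟩
  have hBB : B'ᵀ * B' = P + vecMulVec γ γ := by
    ext i j
    simp [hB', hP, Matrix.mul_apply, Fin.sum_univ_castSucc, vecMulVec_apply]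
  have hQ1 : Q * (B'ᵀ * B') = 1 := by
    have e1 : ζ ᵥ* P = γ := by rw [← hPs, Matrix.vecMul_transpose, hPζ]
    rw [hBB, hQ, Matrix.sub_mul, Matrix.mul_add, Matrix.nonsing_inv_mul _ hPu,
      Matrix.mul_vecMulVec, ← hζ, Matrix.smul_mul, Matrix.mul_add, Matrix.vecMulVec_mul, e1,
      Matrix.vecMulVec_mul_vecMulVec]
    have e2 : ζ ⬝ᵥ γ = d - 1 := by rw [hd, dotProduct_comm]; ring
    rw [e2]
    ext i j
    simp [vecMulVec_apply]
    field_simp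
    ring
  have hQγ : Q *ᵥ γ = d⁻¹ • ζ := by
    have e2 : ζ ⬝ᵥ γ = d - 1 := by rw [hd, dotProduct_comm]; ring
    rw [hQ, Matrix.sub_mulVec, ← hζ, Matrix.smul_mulVec, Matrix.vecMulVec_mulVec, e2]
    ext i
    simp
    field_simp
    ring
  have hA1 : A' = B' * C := by
    rw [hA', hB', hA, hdep]
    ext i j
    refine Fin.lastCases ?_ (fun i => ?_) i
    · simp [Matrix.mul_apply, Matrix.mulVec, dotProduct, mul_comm]
    · simp [Matrix.mul_apply]
  have hX1 : X' = Ctildeᵀ * (Q * B'ᵀ) := by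
    have hK' : K = Ctildeᵀ *ᵥ (Q *ᵥ γ) := by
      rw [hQγ, hK, Matrix.mulVec_smul, ← hd]
      ext i
      simp [div_eq_inv_mul]
    have hM : Aplus - vecMulVec K b = Ctildeᵀ * (Q * Bᵀ) := by
      rw [hK', hQγ, hAplus, hQ, hb, Matrix.sub_mul, Matrix.mul_sub, Matrix.smul_mul,
        Matrix.vecMulVec_mul, Matrix.vecMul_transpose, Matrix.mul_assoc, Matrix.mul_smul,
        Matrix.mul_vecMulVec, Matrix.mulVec_smul, Matrix.smul_vecMulVec]
    ext i j
    refine Fin.lastCases ?_ (fun j => ?_) j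
    · rw [hX', ← Matrix.mul_assoc, hK', Matrix.mulVec_mulVec]
      simp [hB', Matrix.mul_apply (M := Ctildeᵀ * Q), Matrix.mulVec, dotProduct]
    · have := congrFun (congrFun hM i) j
      rw [← Matrix.mul_assoc, Matrix.mul_apply] at this
      rw [hX', ← Matrix.mul_assoc, Matrix.mul_apply]
      simp [hB', vecMulVec_apply] at this ⊢
      rw [← this]; ring
  have hCD : C * Ctildeᵀ = 1 := by
    rw [hCtilde, transpose_mul, hGis, ← Matrix.mul_assoc, Matrix.mul_nonsing_inv _ hCu]
  have hDC : (Ctildeᵀ * C)ᵀ = Ctildeᵀ * C := by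
    rw [hCtilde]
    simp only [transpose_mul, hGis, transpose_transpose, Matrix.mul_assoc]
  have hAX : A' * X' = B' * (Q * B'ᵀ) := by
    rw [hA1, hX1, Matrix.mul_assoc, ← Matrix.mul_assoc C, hCD, Matrix.one_mul]
  have hLB : Q * B'ᵀ * B' = 1 := by rw [Matrix.mul_assoc, hQ1]
  have hXA : X' * A' = Ctildeᵀ * C := by
    rw [hA1, hX1, Matrix.mul_assoc, ← Matrix.mul_assoc _ B', hLB, Matrix.one_mul]
  refine ⟨?_, ?_, ?_, ?_⟩
  · rw [hAX, hA1, Matrix.mul_assoc, ← Matrix.mul_assoc _ B', hLB, Matrix.one_mul]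
  · rw [hXA, hX1, Matrix.mul_assoc, ← Matrix.mul_assoc C, hCD, Matrix.one_mul]
  · rw [hAX]
    simp only [transpose_mul, hQs, transpose_transpose, Matrix.mul_assoc]
  · rw [hXA, hDC]
end

section
/- Let B be a real n×r matrix of rank r, C a real r×m matrix of rank r, A = B·C, Y ∈ ℝⁿ, and x := Cᵀ(C·Cᵀ)⁻¹(Bᵀ·B)⁻¹Bᵀ·Y (the minimum-norm least-squares solution A⁺Y). Let Γ ∈ ℝᵐ have nonzero rejection Γ⊥ := Γ − Cᵀ(C·Cᵀ)⁻¹·C·Γ ≠ 0, let y ∈ ℝ, and let b := B·(Bᵀ·B)⁻¹(C·Cᵀ)⁻¹·C·Γ. Then the updated solution x' := ([A⁺ | 0] + (Γ⊥/‖Γ⊥‖²)·[−bᵀ | 1]) applied to the vector (Y, y) ∈ ℝⁿ⁺¹ satisfies x' = x + (Γ⊥/‖Γ⊥‖²)·(y − Γᵀ·x). -/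
open Matrix

/-- Recursive least-squares update formula when the new observation `Γ` has a
nonzero rejection (linearly independent case):
`x' = x + (Γ⊥ / ‖Γ⊥‖²) * (y - Γᵀ x)`. -/
theorem stmt_3 {n m r : ℕ}
    (B : Matrix (Fin n) (Fin r) ℝ) (C : Matrix (Fin r) (Fin m) ℝ)
    (hB : B.rank = r) (hC : C.rank = r)
    (A : Matrix (Fin n) (Fin m) ℝ) (hA : A = B * C)
    (Y : Fin n → ℝ)
    (Aplus : Matrix (Fin m) (Fin n) ℝ)
    (hAplus : Aplus = Cᵀ * (C * Cᵀ)⁻¹ * (Bᵀ * B)⁻¹ * Bᵀ)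
    (x : Fin m → ℝ) (hx : x = Aplus.mulVec Y)
    (Γ : Fin m → ℝ)
    (Γperp : Fin m → ℝ)
    (hperp : Γperp = Γ - Cᵀ.mulVec ((C * Cᵀ)⁻¹.mulVec (C.mulVec Γ)))
    (hne : Γperp ≠ 0)
    (y : ℝ)
    (b : Fin n → ℝ)
    (hb : b = B.mulVec ((Bᵀ * B)⁻¹.mulVec ((C * Cᵀ)⁻¹.mulVec (C.mulVec Γ))))
    (K : Fin m → ℝ) (hK : K = fun i => Γperp i / (Γperp ⬝ᵥ Γperp))
    (X' : Matrix (Fin m) (Fin (n + 1)) ℝ)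
    (hX' : X' = Matrix.of fun i => Fin.snoc (fun j => Aplus i j + K i * (-(b j))) (K i))
    (x' : Fin m → ℝ) (hx' : x' = X'.mulVec (Fin.snoc Y y)) :
    x' = x + (y - Γ ⬝ᵥ x) • K := by
  have hbA : b = Aplusᵀ *ᵥ Γ := by
    rw [hb, hAplus]
    simp only [Matrix.transpose_mul, Matrix.transpose_nonsing_inv, Matrix.transpose_transpose,
      Matrix.mulVec_mulVec, Matrix.mul_assoc]
  have hbY : Γ ⬝ᵥ x = b ⬝ᵥ Y := by
    rw [hx, hbA, Matrix.dotProduct_mulVec, Matrix.mulVec_transpose]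
  rw [hbY, hx', hX', hx]
  funext i
  simp only [Matrix.mulVec, dotProduct, Matrix.of_apply, Fin.sum_univ_castSucc, Fin.snoc_castSucc,
    Fin.snoc_last, Pi.add_apply, Pi.smul_apply, smul_eq_mul]
  have h : ∑ j, (Aplus i j + K i * (-(b j))) * Y j
      = ∑ j, Aplus i j * Y j - K i * ∑ j, b j * Y j := by
    rw [Finset.mul_sum, ← Finset.sum_sub_distrib]
    exact Finset.sum_congr rfl fun j _ => by ring
  rw [h]
  ring
end

section
/- Let B be a real n×r matrix of rank r, C a real r×m matrix of rank r, A = B·C, Y ∈ ℝⁿ, and x := C̃ᵀ·P⁻¹·Bᵀ·Y where P := Bᵀ·B and C̃ := (C·Cᵀ)⁻¹·C. Let Γ ∈ ℝᵐ satisfy Γ = Cᵀ·γ with γ := C̃·Γ, let y ∈ ℝ, and set ζ := P⁻¹·γ, b := B·ζ. Then the updated solution x' := ([A⁺ | 0] + (C̃ᵀ·ζ)/(1 + γᵀ·ζ)·[−bᵀ | 1]) applied to the vector (Y, y) ∈ ℝⁿ⁺¹, where A⁺ = C̃ᵀ·P⁻¹·Bᵀ, satisfies x' = x + (C̃ᵀ·ζ)/(1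 + γᵀ·ζ)·(y − Γᵀ·x). -/
open Matrix

/-- Recursive least-squares update formula when the new observation `Γ` lies in
the row space of `A = B * C` (linearly dependent case):
`x' = x + (C̃ᵀ ζ / (1 + γᵀ ζ)) * (y - Γᵀ x)`. -/
theorem stmt_4 {n m r : ℕ}
    (B : Matrix (Fin n) (Fin r) ℝ) (C : Matrix (Fin r) (Fin m) ℝ)
    (hB : B.rank = r) (hC : C.rank = r)
    (A : Matrix (Fin n) (Fin m) ℝ) (hA : A = B * C)
    (Y : Fin n → ℝ)
    (P : Matrix (Fin r) (Fin r) ℝ) (hP : P = Bᵀ * B)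
    (Ctilde : Matrix (Fin r) (Fin m) ℝ) (hCtilde : Ctilde = (C * Cᵀ)⁻¹ * C)
    (Aplus : Matrix (Fin m) (Fin n) ℝ) (hAplus : Aplus = Ctildeᵀ * P⁻¹ * Bᵀ)
    (x : Fin m → ℝ) (hx : x = Aplus.mulVec Y)
    (Γ : Fin m → ℝ) (γ : Fin r → ℝ) (hγ : γ = Ctilde.mulVec Γ)
    (hdep : Γ = Cᵀ.mulVec γ)
    (y : ℝ)
    (ζ : Fin r → ℝ) (hζ : ζ = P⁻¹.mulVec γ)
    (b : Fin n → ℝ) (hb : b = B.mulVec ζ)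
    (K : Fin m → ℝ)
    (hK : K = fun i => (Ctildeᵀ.mulVec ζ) i / (1 + γ ⬝ᵥ ζ))
    (X' : Matrix (Fin m) (Fin (n + 1)) ℝ)
    (hX' : X' = Matrix.of fun i => Fin.snoc (fun j => Aplus i j + K i * (-(b j))) (K i))
    (x' : Fin m → ℝ) (hx' : x' = X'.mulVec (Fin.snoc Y y)) :
    x' = x + (y - Γ ⬝ᵥ x) • K := by
  have hsymm : (P⁻¹)ᵀ = P⁻¹ := by
    rw [Matrix.transpose_nonsing_inv, hP, Matrix.transpose_mul, Matrix.transpose_transpose]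
  have key : Γ ⬝ᵥ x = b ⬝ᵥ Y := by
    have h1 : Γ ⬝ᵥ x = γ ⬝ᵥ (P⁻¹ *ᵥ (Bᵀ *ᵥ Y)) := by
      rw [hx, hAplus, ← Matrix.mulVec_mulVec, ← Matrix.mulVec_mulVec, Matrix.dotProduct_mulVec,
        Matrix.vecMul_transpose, ← hγ]
    rw [h1, Matrix.dotProduct_mulVec, ← Matrix.mulVec_transpose, hsymm, ← hζ,
      Matrix.dotProduct_mulVec, Matrix.vecMul_transpose, ← hb]
  rw [key, hx', hX', hx]
  funext i
  simp only [Matrix.mulVec, dotProduct, Matrix.of_apply, Fin.sum_univ_castSucc,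
    Fin.snoc_castSucc, Fin.snoc_last, Pi.add_apply, Pi.smul_apply, smul_eq_mul]
  have h2 : ∑ j, (Aplus i j + K i * -b j) * Y j
      = ∑ j, Aplus i j * Y j - K i * ∑ j, b j * Y j := by
    rw [Finset.mul_sum, ← Finset.sum_sub_distrib]
    exact Finset.sum_congr rfl fun j _ => by ring
  rw [h2]
  ring
end

section
/- Let C be a real r×m matrix of rank r and Γ ∈ ℝᵐ with rejection Γ⊥ := Γ − Cᵀ(C·Cᵀ)⁻¹·C·Γ ≠ 0, and set γ := (C·Cᵀ)⁻¹·C·Γ and C̃ := (C·Cᵀ)⁻¹·C. Let C' be the (r+1)×m matrix obtained from C by appending the row Γᵀ. Then C'·C'ᵀ is invertible and (C'·C'ᵀ)⁻¹·C' equals the (r+1)×m matrix whose first r rows are C̃ − γ·(Γ⊥ᵀ/‖Γ⊥‖²) and whose last row is Γ⊥ᵀ/‖Γ⊥‖². -/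
open Matrix

/-- Update of the dual basis matrix `C̃ = (C Cᵀ)⁻¹ C` when a row `Γᵀ` with
nonzero rejection is appended to `C`. -/
theorem stmt_5 {m r : ℕ}
    (C : Matrix (Fin r) (Fin m) ℝ) (hC : C.rank = r)
    (Γ : Fin m → ℝ)
    (γ : Fin r → ℝ) (hγ : γ = (C * Cᵀ)⁻¹.mulVec (C.mulVec Γ))
    (Ctilde : Matrix (Fin r) (Fin m) ℝ) (hCtilde : Ctilde = (C * Cᵀ)⁻¹ * C)
    (Γperp : Fin m → ℝ) (hperp : Γperp = Γ - Cᵀ.mulVec γ)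
    (hne : Γperp ≠ 0)
    (C' : Matrix (Fin (r + 1)) (Fin m) ℝ)
    (hC' : C' = Matrix.of (Fin.snoc (fun i => C i) Γ)) :
    IsUnit (C' * C'ᵀ) ∧
      (C' * C'ᵀ)⁻¹ * C' =
        Matrix.of (Fin.snoc
          (fun i j => Ctilde i j - γ i * (Γperp j / (Γperp ⬝ᵥ Γperp)))
          (fun j => Γperp j / (Γperp ⬝ᵥ Γperp))) := by
  have hG : IsUnit (C * Cᵀ) := by
    have h1 : (C * Cᵀ).rank = r := by rw [Matrix.rank_self_mul_transpose, hC]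
    have h2 : LinearIndependent ℝ (C * Cᵀ).row := by
      rw [linearIndependent_iff_card_eq_finrank_span, Set.finrank,
        ← Matrix.rank_eq_finrank_span_row, h1, Fintype.card_fin]
    exact Matrix.linearIndependent_rows_iff_isUnit.mp h2
  have hGd : IsUnit (C * Cᵀ).det := (Matrix.isUnit_iff_isUnit_det _).mp hG
  have hs : Γperp ⬝ᵥ Γperp ≠ 0 := fun h => hne (dotProduct_self_eq_zero.mp h)
  have hCp : C *ᵥ Γperp = 0 := by
    rw [hperp, Matrix.mulVec_sub, Matrix.mulVec_mulVec, hγ, Matrix.mulVec_mulVec,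
      Matrix.mul_nonsing_inv _ hGd, Matrix.one_mulVec, sub_self]
  have hΓp : Γperp ⬝ᵥ Γ = Γperp ⬝ᵥ Γperp := by
    have : Γ = Γperp + Cᵀ *ᵥ γ := by rw [hperp]; simp
    conv_lhs => rw [this]
    rw [dotProduct_add, Matrix.dotProduct_mulVec, Matrix.vecMul_transpose, hCp]
    simp
  have hT1 : Ctilde * Cᵀ = 1 := by
    rw [hCtilde, Matrix.mul_assoc, Matrix.nonsing_inv_mul _ hGd]
  have hT2 : Ctilde *ᵥ Γ = γ := by
    rw [hCtilde, hγ, Matrix.mulVec_mulVec]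
  have hpj : ∀ j, Γperp j = Γ j - ∑ k, γ k * C k j := by
    intro j
    rw [hperp]
    simp [Matrix.mulVec, dotProduct, mul_comm]
  have hTj : ∀ i j, Ctilde i j = ∑ k, (C * Cᵀ)⁻¹ i k * C k j := by
    intro i j
    rw [hCtilde, Matrix.mul_apply]
  set s := Γperp ⬝ᵥ Γperp with hsdef
  set D : Matrix (Fin (r + 1)) (Fin m) ℝ := Matrix.of (Fin.snoc
          (fun i j => Ctilde i j - γ i * (Γperp j / s))
          (fun j => Γperp j / s)) with hD
  have key : ∀ v : Fin m → ℝ, (∑ j, Γperp j / s * v j) = (Γperp ⬝ᵥ v) / s := by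
    intro v
    rw [dotProduct, Finset.sum_div]
    exact Finset.sum_congr rfl fun j _ => by ring
  have key2 : ∀ (i : Fin r) (v : Fin m → ℝ),
      (∑ j, (Ctilde i j - γ i * (Γperp j / s)) * v j)
        = (Ctilde *ᵥ v) i - γ i * ((Γperp ⬝ᵥ v) / s) := by
    intro i v
    rw [← key, Finset.mul_sum, Matrix.mulVec, dotProduct, ← Finset.sum_sub_distrib]
    exact Finset.sum_congr rfl fun j _ => by ring
  have hCk : ∀ k, Γperp ⬝ᵥ C k = 0 := by
    intro k
    rw [dotProduct_comm]
    exact congrFun hCp k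
  have hTk : ∀ i k, (Ctilde *ᵥ C k) i = (1 : Matrix (Fin r) (Fin r) ℝ) i k := by
    intro i k
    rw [← hT1]
    rfl
  have hDC : D * C'ᵀ = 1 := by
    ext a b
    rw [Matrix.mul_apply, hC', hD]
    refine Fin.lastCases ?_ (fun i => ?_) a <;> refine Fin.lastCases ?_ (fun k => ?_) b
    · simp only [Matrix.of_apply, Matrix.transpose_apply, Fin.snoc_last]
      rw [key, hΓp, div_self hs]; simp
    · simp only [Matrix.of_apply, Matrix.transpose_apply, Fin.snoc_last, Fin.snoc_castSucc]
      rw [key, hCk, Matrix.one_apply_ne (Fin.castSucc_lt_last k).ne']; simp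
    · simp only [Matrix.of_apply, Matrix.transpose_apply, Fin.snoc_last, Fin.snoc_castSucc]
      rw [key2, hΓp, div_self hs, hT2, Matrix.one_apply_ne (Fin.castSucc_lt_last i).ne]; simp
    · simp only [Matrix.of_apply, Matrix.transpose_apply, Fin.snoc_castSucc]
      rw [key2, hCk, hTk]; simp [Matrix.one_apply]
  obtain ⟨M, hM⟩ : ∃ M : Matrix (Fin (r + 1)) (Fin (r + 1)) ℝ, M * C' = D := by
    refine ⟨Matrix.of (Fin.snoc
      (fun i => Fin.snoc (fun k => (C * Cᵀ)⁻¹ i k + γ i * (γ k / s)) (-(γ i / s)))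
      (Fin.snoc (fun k => -(γ k / s)) (1 / s))), ?_⟩
    ext a j
    rw [Matrix.mul_apply, hC', hD, Fin.sum_univ_castSucc]
    refine Fin.lastCases ?_ (fun i => ?_) a
    · simp only [Matrix.of_apply, Fin.snoc_last, Fin.snoc_castSucc]
      rw [hpj, sub_div, Finset.sum_div, sub_eq_add_neg, ← Finset.sum_neg_distrib, add_comm]
      congr 1
      · ring
      · exact Finset.sum_congr rfl fun k _ => by ring
    · simp only [Matrix.of_apply, Fin.snoc_last, Fin.snoc_castSucc]
      have : ∑ k, ((C * Cᵀ)⁻¹ i k + γ i * (γ k / s)) * C k j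
          = Ctilde i j + γ i / s * ∑ k, γ k * C k j := by
        rw [hTj, Finset.mul_sum, ← Finset.sum_add_distrib]
        exact Finset.sum_congr rfl fun k _ => by ring
      rw [this, hpj]
      ring
  have hinv : M * (C' * C'ᵀ) = 1 := by rw [← Matrix.mul_assoc, hM, hDC]
  refine ⟨IsUnit.of_mul_eq_one_right M hinv, ?_⟩
  rw [Matrix.inv_eq_left_inv hinv, hM]
end

section
/- Let B be a real n×r matrix of rank r, C a real r×m matrix of rank r, A = B·C, and Γ ∈ ℝᵐ with rejection Γ⊥ := Γ − Cᵀ(C·Cᵀ)⁻¹·C·Γ ≠ 0. Define B' as the (n+1)×(r+1) block-diagonal matrix [[B, 0], [0, 1]] and C' as the (r+1)×m matrix obtained from C by appending the row Γᵀ. Then B'·C' = A', where A' is A with the row Γᵀ appended; B' has rank r+1; and C' has rank r+1. Hence (B', C') is a full-rank factorization of A' and A' has rank r+1. -/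
open Matrix

theorem aux_li {k l : ℕ} (M : Matrix (Fin k) (Fin l) ℝ) (h : M.rank = k) :
    LinearIndependent ℝ M.row := by
  rw [linearIndependent_iff_card_eq_finrank_span, Set.finrank, ← Matrix.rank_eq_finrank_span_row, h]
  simp

theorem aux_unit {k : ℕ} (M : Matrix (Fin k) (Fin k) ℝ) (h : M.rank = k) : IsUnit M :=
  Matrix.linearIndependent_rows_iff_isUnit.mp (aux_li M h)

/-- Full-rank factorization update in the linearly independent case: appending a
row `Γᵀ` with nonzero rejection to `A = B * C` yields the full-rank factorization
`A' = B' * C'` with `B' = [[B, 0], [0, 1]]` and `C'` obtained by appending `Γᵀ`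
to `C`; all of `B'`, `C'`, `A'` have rank `r + 1`. -/
theorem stmt_7 {n m r : ℕ}
    (B : Matrix (Fin n) (Fin r) ℝ) (C : Matrix (Fin r) (Fin m) ℝ)
    (hB : B.rank = r) (hC : C.rank = r)
    (A : Matrix (Fin n) (Fin m) ℝ) (hA : A = B * C)
    (Γ : Fin m → ℝ)
    (Γperp : Fin m → ℝ)
    (hperp : Γperp = Γ - Cᵀ.mulVec ((C * Cᵀ)⁻¹.mulVec (C.mulVec Γ)))
    (hne : Γperp ≠ 0)
    (A' : Matrix (Fin (n + 1)) (Fin m) ℝ)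
    (hA' : A' = Matrix.of (Fin.snoc (fun i => A i) Γ))
    (B' : Matrix (Fin (n + 1)) (Fin (r + 1)) ℝ)
    (hB' : B' = Matrix.of (Fin.snoc (fun i => Fin.snoc (B i) 0)
      (Fin.snoc (fun _ => (0 : ℝ)) 1)))
    (C' : Matrix (Fin (r + 1)) (Fin m) ℝ)
    (hC' : C' = Matrix.of (Fin.snoc (fun i => C i) Γ)) :
    B' * C' = A' ∧ B'.rank = r + 1 ∧ C'.rank = r + 1 ∧ A'.rank = r + 1 := by
  have hC1 : C'.rank = r + 1 := by
    have hli : LinearIndependent ℝ C'.row := by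
      have : C'.row = Fin.snoc (fun i => C i) Γ := by rw [hC']; rfl
      rw [this, linearIndependent_finSnoc]
      refine ⟨aux_li C hC, fun hmem => hne ?_⟩
      obtain ⟨x, hx⟩ := (Submodule.mem_span_range_iff_exists_fun ℝ).1 hmem
      have hx' : Γ = Cᵀ *ᵥ x := by
        rw [← hx]
        ext j
        simp [Matrix.mulVec, dotProduct, mul_comm]
      have hu : IsUnit (C * Cᵀ) := aux_unit _ (by rw [Matrix.rank_self_mul_transpose, hC])
      rw [hperp, hx', Matrix.mulVec_mulVec x C, Matrix.mulVec_mulVec x (C * Cᵀ)⁻¹,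
        Matrix.nonsing_inv_mul _ ((Matrix.isUnit_iff_isUnit_det _).1 hu)]
      simp
    simpa using hli.rank_matrix
  have hB1 : B'.rank = r + 1 := by
    have hBi : Function.Injective B.mulVec := by
      rw [Matrix.mulVec_injective_iff]
      exact aux_li Bᵀ (by rw [Matrix.rank_transpose, hB])
    have hli : LinearIndependent ℝ B'ᵀ.row := by
      have h : Function.Injective B'.mulVec := by
        intro u v huv
        have h1 : B *ᵥ (fun i => u i.castSucc) = B *ᵥ (fun i => v i.castSucc) := by
          ext i
          have := congrFun huv i.castSucc
          simpa [hB', Matrix.mulVec, dotProduct, Fin.sum_univ_castSucc] using this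
        have h2 := congrFun huv (Fin.last n)
        simp [hB', Matrix.mulVec, dotProduct, Fin.sum_univ_castSucc] at h2
        have h3 := hBi h1
        ext i
        refine Fin.lastCases h2 (fun j => congrFun h3 j) i
      exact Matrix.mulVec_injective_iff.1 h
    rw [← Matrix.rank_transpose]
    simpa using hli.rank_matrix
  have hM : B' * C' = A' := by
    ext i j
    subst hA' hB' hC' hA
    refine Fin.lastCases ?_ (fun i => ?_) i <;>
      simp [Matrix.mul_apply, Fin.sum_univ_castSucc]
  refine ⟨hM, hB1, hC1, ?_⟩
  have hu : IsUnit (B'ᵀ * B') := aux_unit _ (by rw [Matrix.rank_transpose_mul_self, hB1])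
  have e := Matrix.rank_mul_eq_right_of_isUnit_det (B'ᵀ * B') C'
    ((Matrix.isUnit_iff_isUnit_det _).1 hu)
  rw [Matrix.mul_assoc, hM, hC1] at e
  have h1 := Matrix.rank_mul_le_right B'ᵀ A'
  have h2 := Matrix.rank_mul_le_right B' C'
  rw [hM, hC1] at h2
  omega
end

section
/- Let C be a real r×m matrix of rank r, Γ ∈ ℝᵐ with rejection Γ⊥ := Γ − Cᵀ(C·Cᵀ)⁻¹·C·Γ ≠ 0, and let α ≠ 0 be a real number. Let C' be the (r+1)×m matrix obtained from C by appending the row α·Γ⊥ᵀ. Then C'·C'ᵀ is invertible and (C'·C'ᵀ)⁻¹·C' equals the (r+1)×m matrix whose first r rows are C̃ := (C·Cᵀ)⁻¹·C and whose last row is Γ⊥ᵀ/(α·‖Γ⊥‖²). -/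
open Matrix

/-- Dual basis update in the orthogonal-basis variant: appending the rescaled
rejection `α • Γ⊥` as a new row of `C` keeps the first `r` rows of the dual
basis matrix unchanged and appends the row `Γ⊥ᵀ / (α ‖Γ⊥‖²)`. -/
theorem stmt_16 {m r : ℕ}
    (C : Matrix (Fin r) (Fin m) ℝ) (hC : C.rank = r)
    (Γ : Fin m → ℝ)
    (Γperp : Fin m → ℝ)
    (hperp : Γperp = Γ - Cᵀ.mulVec ((C * Cᵀ)⁻¹.mulVec (C.mulVec Γ)))
    (hne : Γperp ≠ 0)
    (α : ℝ) (hα : α ≠ 0)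
    (Ctilde : Matrix (Fin r) (Fin m) ℝ) (hCtilde : Ctilde = (C * Cᵀ)⁻¹ * C)
    (C' : Matrix (Fin (r + 1)) (Fin m) ℝ)
    (hC' : C' = Matrix.of (Fin.snoc (fun i => C i) (α • Γperp))) :
    IsUnit (C' * C'ᵀ) ∧
      (C' * C'ᵀ)⁻¹ * C' =
        Matrix.of (Fin.snoc (fun i => Ctilde i)
          (fun j => Γperp j / (α * (Γperp ⬝ᵥ Γperp)))) := by
  have hG : IsUnit (C * Cᵀ) := by
    rw [← Matrix.linearIndependent_rows_iff_isUnit, linearIndependent_iff_card_eq_finrank_span,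
      Set.finrank, ← Matrix.rank_eq_finrank_span_row, Matrix.rank_self_mul_transpose, hC,
      Fintype.card_fin]
  have hdet : IsUnit (C * Cᵀ).det := (Matrix.isUnit_iff_isUnit_det _).1 hG
  have h0 : C *ᵥ Γperp = 0 := by
    rw [hperp, Matrix.mulVec_sub, Matrix.mulVec_mulVec, Matrix.mulVec_mulVec,
      Matrix.mul_nonsing_inv _ hdet, Matrix.one_mulVec, sub_self]
  have h1 : Ctilde *ᵥ Γperp = 0 := by
    rw [hCtilde, ← Matrix.mulVec_mulVec, h0, Matrix.mulVec_zero]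
  have h2 : (C * Cᵀ) * Ctilde = C := by
    rw [hCtilde, Matrix.mul_nonsing_inv_cancel_left _ _ hdet]
  have h3 : C * Ctildeᵀ = 1 := by
    have : Ctilde * Cᵀ = 1 := by
      rw [hCtilde, Matrix.mul_assoc, Matrix.nonsing_inv_mul _ hdet]
    rw [← Matrix.transpose_one, ← this, Matrix.transpose_mul, Matrix.transpose_transpose]
  have hg : Γperp ⬝ᵥ Γperp ≠ 0 := fun h => hne (dotProduct_self_eq_zero.1 h)
  set g := Γperp ⬝ᵥ Γperp with hgdef
  have h0' : ∀ i, C i ⬝ᵥ Γperp = 0 := fun i => congrFun h0 i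
  have h1' : ∀ i, Ctilde i ⬝ᵥ Γperp = 0 := fun i => congrFun h1 i
  have h3' : ∀ i k, C i ⬝ᵥ Ctilde k = (1 : Matrix (Fin r) (Fin r) ℝ) i k :=
    fun i k => congrFun (congrFun h3 i) k
  have hv : (fun j => Γperp j / (α * g)) = (α * g)⁻¹ • Γperp := by
    ext j; simp [div_eq_inv_mul]
  rw [hv]
  set D : Matrix (Fin (r + 1)) (Fin m) ℝ :=
    Matrix.of (Fin.snoc (fun i => Ctilde i) ((α * g)⁻¹ • Γperp)) with hD
  have c1 : ∀ i : Fin r, C' i.castSucc = C i := fun i => by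
    rw [hC']; exact Fin.snoc_castSucc (α := fun _ => Fin m → ℝ) _ _ _
  have c2 : C' (Fin.last r) = α • Γperp := by
    rw [hC']; exact Fin.snoc_last (α := fun _ => Fin m → ℝ) _ _
  have d1 : ∀ i : Fin r, D i.castSucc = Ctilde i := fun i => by
    exact Fin.snoc_castSucc (α := fun _ => Fin m → ℝ) _ _ _
  have d2 : D (Fin.last r) = (α * g)⁻¹ • Γperp := by
    exact Fin.snoc_last (α := fun _ => Fin m → ℝ) _ _
  have e : ∀ i k, (C' * C'ᵀ) i k = C' i ⬝ᵥ C' k := fun i k => rfl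
  have k1 : (C' * C'ᵀ) * D = C' := by
    ext i j
    rw [Matrix.mul_apply, Fin.sum_univ_castSucc]
    simp only [e]
    induction i using Fin.lastCases with
    | last =>
      simp only [c1, c2, d1, d2, smul_dotProduct, dotProduct_smul, dotProduct_comm Γperp (C _), h0',
        ← hgdef, Pi.smul_apply, smul_eq_mul]
      simp
      field_simp
    | cast i =>
      simp only [c1, c2, d1, d2, dotProduct_smul, h0']
      have := congrFun (congrFun h2 i) j
      rw [Matrix.mul_apply] at this
      simp only [smul_zero, zero_mul, add_zero]
      exact this
  have k2 : C' * Dᵀ = 1 := by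
    ext i k
    change C' i ⬝ᵥ D k = _
    induction i using Fin.lastCases with
    | last =>
      induction k using Fin.lastCases with
      | last =>
        simp only [c2, d2, smul_dotProduct, dotProduct_smul, ← hgdef, smul_eq_mul, Matrix.one_apply_eq]
        field_simp
      | cast k =>
        rw [c2, d1, smul_dotProduct, dotProduct_comm, h1', smul_zero,
          Matrix.one_apply_ne (Fin.castSucc_lt_last k).ne']
    | cast i =>
      induction k using Fin.lastCases with
      | last =>
        rw [c1, d2, dotProduct_smul, h0', smul_zero,
          Matrix.one_apply_ne (Fin.castSucc_lt_last i).ne]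
      | cast k =>
        rw [c1, d1, h3']
        simp [Matrix.one_apply]
  have hU : IsUnit (C' * C'ᵀ) := by
    refine IsUnit.of_mul_eq_one (D * Dᵀ) ?_
    rw [← Matrix.mul_assoc, k1, k2]
  refine ⟨hU, ?_⟩
  have hd := (Matrix.isUnit_iff_isUnit_det _).1 hU
  calc (C' * C'ᵀ)⁻¹ * C' = (C' * C'ᵀ)⁻¹ * ((C' * C'ᵀ) * D) := by rw [k1]
    _ = D := Matrix.nonsing_inv_mul_cancel_left _ _ hd
end

section
/- Let B be a real n×r matrix of rank r with P := Bᵀ·B, let γ ∈ ℝʳ, ζ := P⁻¹·γ, and let α ≠ 0 be a real number. Let B' be the (n+1)×(r+1) block matrix [[B, 0], [γᵀ, 1/α]]. Then B'ᵀ·B' is invertible and (B'ᵀ·B')⁻¹ equals the block matrix [[P⁻¹, −α·ζ], [−α·ζᵀ, α²·(1 + γᵀ·ζ)]]. -/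
open Matrix

/-- Gram-inverse update in the orthogonal-basis variant: for
`B' = [[B, 0], [γᵀ, 1/α]]`, the Gram matrix `B'ᵀ B'` is invertible with inverse
`[[P⁻¹, -α ζ], [-α ζᵀ, α² (1 + γᵀ ζ)]]`. -/
theorem stmt_17 {n r : ℕ}
    (B : Matrix (Fin n) (Fin r) ℝ) (hB : B.rank = r)
    (P : Matrix (Fin r) (Fin r) ℝ) (hP : P = Bᵀ * B)
    (γ : Fin r → ℝ) (ζ : Fin r → ℝ) (hζ : ζ = P⁻¹.mulVec γ)
    (α : ℝ) (hα : α ≠ 0)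
    (B' : Matrix (Fin (n + 1)) (Fin (r + 1)) ℝ)
    (hB' : B' = Matrix.of (Fin.snoc (fun i => Fin.snoc (B i) 0)
      (Fin.snoc γ (1 / α)))) :
    IsUnit (B'ᵀ * B') ∧
      (B'ᵀ * B')⁻¹ =
        Matrix.of (Fin.snoc
          (fun i => Fin.snoc (P⁻¹ i) (-(α * ζ i)))
          (Fin.snoc (fun j => -(α * ζ j)) (α ^ 2 * (1 + γ ⬝ᵥ ζ)))) := by
  have hrank : P.rank = r := by rw [hP, Matrix.rank_transpose_mul_self, hB]
  have hPu : IsUnit P := by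
    rw [← Matrix.linearIndependent_cols_iff_isUnit]
    rw [linearIndependent_iff_card_eq_finrank_span, Fintype.card_fin, Set.finrank,
      ← Matrix.rank_eq_finrank_span_cols, hrank]
  have hdet : IsUnit P.det := (Matrix.isUnit_iff_isUnit_det P).1 hPu
  have hPs : Pᵀ = P := by rw [hP]; simp
  have h1 : P * P⁻¹ = 1 := Matrix.mul_nonsing_inv P hdet
  have h2 : P.mulVec ζ = γ := by rw [hζ, Matrix.mulVec_mulVec, h1, Matrix.one_mulVec]
  have h3 : Matrix.vecMul γ P⁻¹ = ζ := by
    rw [hζ, ← Matrix.mulVec_transpose, Matrix.transpose_nonsing_inv, hPs]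
  have e1 : ∀ i j, ∑ k, P i k * P⁻¹ k j = (1 : Matrix (Fin r) (Fin r) ℝ) i j := by
    intro i j; rw [← h1, Matrix.mul_apply]
  have e2 : ∀ i, ∑ k, P i k * ζ k = γ i := fun i => congrFun h2 i
  have e3 : ∀ j, ∑ k, γ k * P⁻¹ k j = ζ j := fun j => congrFun h3 j
  have eP : ∀ i j, ∑ k, B k i * B k j = P i j := by
    intro i j; rw [hP, Matrix.mul_apply]; rfl
  have g1 : ∀ i j : Fin r, (B'ᵀ * B') i.castSucc j.castSucc = P i j + γ i * γ j := by
    intro i j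
    simp [Matrix.mul_apply, Fin.sum_univ_castSucc, hB', eP]
  have g2 : ∀ i : Fin r, (B'ᵀ * B') i.castSucc (Fin.last r) = γ i * (1 / α) := by
    intro i
    simp [Matrix.mul_apply, Fin.sum_univ_castSucc, hB']
  have g3 : ∀ i : Fin r, (B'ᵀ * B') (Fin.last r) i.castSucc = (1 / α) * γ i := by
    intro i
    simp [Matrix.mul_apply, Fin.sum_univ_castSucc, hB']
  have g4 : (B'ᵀ * B') (Fin.last r) (Fin.last r) = (1 / α) * (1 / α) := by
    simp [Matrix.mul_apply, Fin.sum_univ_castSucc, hB']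
  generalize B'ᵀ * B' = G at *
  suffices h : G * Matrix.of (Fin.snoc
          (fun i => Fin.snoc (P⁻¹ i) (-(α * ζ i)))
          (Fin.snoc (fun j => -(α * ζ j)) (α ^ 2 * (1 + γ ⬝ᵥ ζ)))) = 1 from
    ⟨(Matrix.isUnit_iff_isUnit_det G).2 (Matrix.isUnit_det_of_right_inverse h),
      Matrix.inv_eq_right_inv h⟩
  have s1 : ∀ i j, ∑ k, γ i * γ k * P⁻¹ k j = γ i * ζ j := by
    intro i j; rw [← e3, Finset.mul_sum]; simp only [mul_assoc]
  have s2 : ∀ i, ∑ k, P i k * (α * ζ k) = α * γ i := by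
    intro i; rw [← e2, Finset.mul_sum]; exact Finset.sum_congr rfl fun _ _ => by ring
  have s3 : ∀ c : ℝ, ∑ k, c * γ k * (α * ζ k) = c * α * (γ ⬝ᵥ ζ) := by
    intro c; rw [dotProduct, Finset.mul_sum]; exact Finset.sum_congr rfl fun _ _ => by ring
  have s4 : ∀ (c : ℝ) j, ∑ k, c * γ k * P⁻¹ k j = c * ζ j := by
    intro c j; rw [← e3, Finset.mul_sum]; simp only [mul_assoc]
  ext i j
  rw [Matrix.mul_apply, Fin.sum_univ_castSucc]
  refine Fin.lastCases ?_ (fun i => ?_) i <;> refine Fin.lastCases ?_ (fun j => ?_) j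
  · simp only [g3, g4, Matrix.of_apply, Fin.snoc_castSucc, Fin.snoc_last, mul_neg,
      Finset.sum_neg_distrib, s3, Matrix.one_apply_eq]
    field_simp
    ring
  · simp only [g3, g4, Matrix.of_apply, Fin.snoc_castSucc, Fin.snoc_last, mul_neg, s4]
    rw [Matrix.one_apply_ne (Fin.castSucc_lt_last j).ne']
    field_simp
    ring
  · simp only [g1, g2, Matrix.of_apply, Fin.snoc_castSucc, Fin.snoc_last, mul_neg,
      Finset.sum_neg_distrib, add_mul, Finset.sum_add_distrib, s2, s3]
    rw [Matrix.one_apply_ne (Fin.castSucc_lt_last i).ne]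
    field_simp
    ring
  · simp only [g1, g2, Matrix.of_apply, Fin.snoc_castSucc, Fin.snoc_last, mul_neg,
      add_mul, Finset.sum_add_distrib, s4, e1]
    simp only [Matrix.one_apply, Fin.castSucc_inj]
    field_simp
    ring
end
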